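/- arXiv:2112.10062 — 2 statements merged into one kernel-verified Lean document; each statement's English description precedes it below -/
import Mathlib

section
/- Let G be an unmixed bipartite graph on {x₁,...,xₙ} ∪ {y₁,...,yₙ} whose independence complex Δ_G (which has dimension n−1) is connected in codimension two. Then the vertices can be labeled so that: (i) {x_i, y_i} ∈ E(G) for all i; (ii) if {x_i, y_j} ∈ E(G) then i ≤ j+1; (iii) if {x_i, y_j} and {x_j, y_k} are edges then {x_i, y_k} is an edge. -/
/-- The faces of the independence complex of a graph `G`. -/
def IndepFaces {V : Type*} (G : SimpleGraph V) : Set (Finset V) :=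
  {F | ∀ u ∈ F, ∀ v ∈ F, ¬ G.Adj u v}

/-- A facet of a complex: a maximal face. -/
def IsFacet {V : Type*} (Δ : Set (Finset V)) (F : Finset V) : Prop :=
  F ∈ Δ ∧ ∀ G ∈ Δ, F ⊆ G → F = G

/-- `C` is a vertex cover of `G`. -/
def IsVC {V : Type*} (G : SimpleGraph V) (C : Finset V) : Prop :=
  ∀ u v : V, G.Adj u v → u ∈ C ∨ v ∈ C

/-- `C` is a minimal vertex cover of `G`. -/
def IsMinVC {V : Type*} (G : SimpleGraph V) (C : Finset V) : Prop :=
  IsVC G C ∧ ∀ D ⊆ C, IsVC G D → D = C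

/-- Connectedness in codimension two for a complex with facets of cardinality `d`. -/
def ConnCodimTwo {V : Type*} [DecidableEq V] (Δ : Set (Finset V)) (d : ℕ) : Prop :=
  ∀ F E : Finset V, IsFacet Δ F → IsFacet Δ E →
    ∃ (r : ℕ) (c : Fin (r + 1) → Finset V),
      c 0 = F ∧ c (Fin.last r) = E ∧ (∀ i, IsFacet Δ (c i)) ∧
      ∀ i : Fin r, d - 2 ≤ ((c i.castSucc) ∩ (c i.succ)).card

/-- A finite family in a preorder, without three pairwise equivalent members, can be reindexed so
that each relation goes up, or down by at most one step. -/
theorem exists_perm_le_succ_of_preorder {n : ℕ} {α : Type*} [Preorder α] (f : Fin n → α)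
    (hthree : ∀ a b c, a ≠ b → a ≠ c → b ≠ c → f a ≤ f b → f b ≤ f a → f a ≤ f c → f c ≤ f a →
      False) :
    ∃ σ : Equiv.Perm (Fin n), ∀ i j, f (σ i) ≤ f (σ j) → (i : ℕ) ≤ (j : ℕ) + 1 := by
  let key : Fin n → LinearExtension (Antisymmetrization α (· ≤ ·)) :=
    fun a => toLinearExtension (toAntisymmetrization (· ≤ ·) (f a))
  have key_le : ∀ a b, f a ≤ f b → key a ≤ key b := fun a b h => toLinearExtension.monotone h
  have key_eq : ∀ a b, key a = key b → f a ≤ f b ∧ f b ≤ f a := fun a b h => Quotient.exact h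
  have hmono := Tuple.monotone_sort key
  refine ⟨Tuple.sort key, fun i j hij => ?_⟩
  by_contra! hlt
  let k : Fin n := ⟨j + 1, by omega⟩
  have hjk : key (Tuple.sort key j) ≤ key (Tuple.sort key k) :=
    hmono (Fin.le_def.2 (by simp [k]))
  have hki : key (Tuple.sort key k) ≤ key (Tuple.sort key i) :=
    hmono (Fin.le_def.2 (by simp only [k]; omega))
  have hij' := key_le _ _ hij
  have hj := key_eq _ _ (hjk.antisymm (hki.trans hij'))
  have hi := key_eq _ _ ((hjk.trans hki).antisymm hij')
  have hne : ∀ s t : Fin n, (s : ℕ) ≠ t → Tuple.sort key s ≠ Tuple.sort key t :=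
    fun s t hst h => hst (congrArg Fin.val ((Tuple.sort key).injective h))
  exact hthree _ _ _ (hne j k (by simp [k])) (hne j i (by omega))
    (hne k i (by simp only [k]; omega)) hj.1 hj.2 hi.1 hi.2

theorem IsVC.exists_isMinVC_subset {V : Type*} {G : SimpleGraph V} {D : Finset V}
    (hD : IsVC G D) : ∃ C ⊆ D, IsMinVC G C := by
  induction D using Finset.strongInduction with
  | H D ih =>
    by_cases hmin : IsMinVC G D
    · exact ⟨D, subset_rfl, hmin⟩
    · obtain ⟨E, hED, hE, hne⟩ : ∃ E ⊆ D, IsVC G E ∧ E ≠ D := by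
        by_contra! h
        exact hmin ⟨hD, h⟩
      obtain ⟨C, hCE, hC⟩ := ih E (hED.ssubset_of_ne hne) hE
      exact ⟨C, hCE.trans hED, hC⟩

theorem IsFacet.isMinVC_compl {V : Type*} [Fintype V] [DecidableEq V] {G : SimpleGraph V}
    {F : Finset V} (hF : IsFacet (IndepFaces G) F) : IsMinVC G Fᶜ := by
  refine ⟨fun u v huv => ?_, fun D hD hDvc => ?_⟩
  · by_contra! h
    simp only [Finset.mem_compl, not_not] at h
    exact hF.1 u h.1 v h.2 huv
  · have hind : Dᶜ ∈ IndepFaces G := fun u hu v hv huv =>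
      (hDvc u v huv).elim (Finset.mem_compl.1 hu) (Finset.mem_compl.1 hv)
    rw [hF.2 Dᶜ hind (Finset.subset_compl_comm.1 hD), compl_compl]

/-- A vertex cover whose cardinality is that of a matching contains at most one endpoint of each
matching edge. -/
theorem IsVC.not_mem_both_of_matching {V : Type*} {G : SimpleGraph V} {n : ℕ} {x y : Fin n → V}
    (hx : Function.Injective x) (hy : Function.Injective y) (hxy : ∀ i j, x i ≠ y j)
    (hadj : ∀ i, G.Adj (x i) (y i)) {C : Finset V} (hC : IsVC G C) (hcard : C.card = n)
    (j : Fin n) : ¬ (x j ∈ C ∧ y j ∈ C) := by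
  classical
  rintro ⟨hxj, hyj⟩
  have hp : ∀ i, ∃ v ∈ C, v = x i ∨ v = y i := fun i =>
    (hC _ _ (hadj i)).elim (fun h => ⟨_, h, Or.inl rfl⟩) (fun h => ⟨_, h, Or.inr rfl⟩)
  choose p hpC hp using hp
  have hinj : Function.Injective p := fun i k hik => by
    rcases hp i with h | h <;> rcases hp k with h' | h' <;> rw [h, h'] at hik
    · exact hx hik
    · exact (hxy _ _ hik).elim
    · exact (hxy _ _ hik.symm).elim
    · exact hy hik
  have himg : Finset.univ.image p = C :=
    Finset.eq_of_subset_of_card_le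
      (fun v hv => by
        obtain ⟨i, -, rfl⟩ := Finset.mem_image.1 hv
        exact hpC i)
      (by rw [Finset.card_image_of_injective _ hinj, hcard, Finset.card_fin])
  rw [← himg] at hxj hyj
  obtain ⟨i, -, hi⟩ := Finset.mem_image.1 hxj
  obtain ⟨k, -, hk⟩ := Finset.mem_image.1 hyj
  have hij : i = j := by
    rcases hp i with h | h
    · exact hx (h.symm.trans hi)
    · exact (hxy _ _ (hi.symm.trans h)).elim
  have hkj : k = j := by
    rcases hp k with h | h
    · exact (hxy _ _ (h.symm.trans hk)).elim
    · exact hy (h.symm.trans hk)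
  subst hij hkj
  exact hxy _ _ (hi.symm.trans hk)

theorem exists_fin_enum_of_ncard {V : Type*} [Finite V] {S : Set V} {n : ℕ} (h : S.ncard = n) :
    ∃ x : Fin n → V, Function.Injective x ∧ Set.range x = S := by
  let e := Finite.equivFinOfCardEq (α := S) (n := n) h
  refine ⟨fun i => (e.symm i : V), Subtype.val_injective.comp e.symm.injective, ?_⟩
  ext v
  constructor
  · rintro ⟨i, rfl⟩
    exact (e.symm i).2
  · exact fun hv => ⟨e ⟨v, hv⟩, by simp⟩

/-- Hall's theorem for a bipartite graph in which one part is a vertex cover of least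
cardinality. -/
theorem exists_matching_of_card_le_isVC {V : Type*} [Fintype V] {G : SimpleGraph V}
    {n : ℕ} {x : Fin n → V} (hx : Function.Injective x)
    (hcover : ∀ u v, G.Adj u v → u ∈ Set.range x ∨ v ∈ Set.range x)
    (hle : ∀ C : Finset V, IsVC G C → n ≤ C.card) :
    ∃ y : Fin n → V, Function.Injective y ∧ ∀ i, G.Adj (x i) (y i) := by
  classical
  obtain ⟨y, hy, hmem⟩ := (Finset.all_card_le_biUnion_card_iff_exists_injective
    (fun i => G.neighborFinset (x i))).1 fun s => by
      have hvc : IsVC G (sᶜ.image x ∪ s.biUnion fun i => G.neighborFinset (x i)) := by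
        have key : ∀ i v, G.Adj (x i) v →
            x i ∈ sᶜ.image x ∪ s.biUnion (fun i => G.neighborFinset (x i)) ∨
            v ∈ sᶜ.image x ∪ s.biUnion (fun i => G.neighborFinset (x i)) := by
          intro i v hv
          by_cases hi : i ∈ s
          · exact Or.inr (Finset.mem_union_right _ (Finset.mem_biUnion.2 ⟨i, hi, by simpa⟩))
          · exact Or.inl (Finset.mem_union_left _
              (Finset.mem_image_of_mem _ (Finset.mem_compl.2 hi)))
        intro u v huv
        rcases hcover u v huv with ⟨i, rfl⟩ | ⟨i, rfl⟩
        · exact key i v huv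
        · exact (key i u huv.symm).symm
      have h1 := (hle _ hvc).trans (Finset.card_union_le _ _)
      rw [Finset.card_image_of_injective _ hx, Finset.card_compl, Fintype.card_fin] at h1
      have h2 := s.card_le_univ
      rw [Fintype.card_fin] at h2
      omega
  exact ⟨y, hy, fun i => by simpa using hmem i⟩

/-- Let `G` be an unmixed bipartite graph whose independence complex is connected in
codimension two.  Then the vertices can be labeled `x₁,…,xₙ, y₁,…,yₙ` so that
(i) `{xᵢ,yᵢ} ∈ E(G)`; (ii) `{xᵢ,y_j} ∈ E(G)` implies `i ≤ j + 1`; and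
(iii) `{xᵢ,y_j}, {x_j,y_k} ∈ E(G)` imply `{xᵢ,y_k} ∈ E(G)`. -/
theorem stmt14 {V : Type*} [Fintype V] [DecidableEq V] (G : SimpleGraph V)
    (n : ℕ) (V₁ V₂ : Set V) (h1 : V₁.ncard = n) (h2 : V₂.ncard = n)
    (hpart : V₁ ∪ V₂ = Set.univ) (hdisj : V₁ ∩ V₂ = ∅)
    (hbip : ∀ u v : V, G.Adj u v → (u ∈ V₁ ∧ v ∈ V₂) ∨ (u ∈ V₂ ∧ v ∈ V₁))
    (hunmixed : ∀ C : Finset V, IsMinVC G C → C.card = n)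
    (hconn : ConnCodimTwo (IndepFaces G) n) :
    ∃ x y : Fin n → V,
      Function.Injective x ∧ Function.Injective y ∧
      Set.range x = V₁ ∧ Set.range y = V₂ ∧
      (∀ i : Fin n, G.Adj (x i) (y i)) ∧
      (∀ i j : Fin n, G.Adj (x i) (y j) → (i : ℕ) ≤ (j : ℕ) + 1) ∧
      (∀ i j l : Fin n, G.Adj (x i) (y j) → G.Adj (x j) (y l) →
        G.Adj (x i) (y l)) := by
  obtain ⟨x, hx, hxr⟩ := exists_fin_enum_of_ncard h1
  have hle : ∀ C : Finset V, IsVC G C → n ≤ C.card := fun C hC => by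
    obtain ⟨D, hDC, hD⟩ := hC.exists_isMinVC_subset
    exact (hunmixed D hD).symm.trans_le (Finset.card_le_card hDC)
  have hnot : ∀ v, v ∈ V₁ → v ∉ V₂ := fun v hv hv' => by
    have : v ∈ V₁ ∩ V₂ := ⟨hv, hv'⟩
    simp [hdisj] at this
  obtain ⟨y, hy, hadj⟩ := exists_matching_of_card_le_isVC (G := G) hx
    (fun u v huv => by
      rw [hxr]
      exact (hbip u v huv).imp And.left And.right) hle
  have hx1 : ∀ i, x i ∈ V₁ := fun i => hxr ▸ Set.mem_range_self i
  have hy2 : ∀ i, y i ∈ V₂ := fun i => by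
    rcases hbip _ _ (hadj i) with h | h
    · exact h.2
    · exact (hnot _ (hx1 i) h.1).elim
  have hyr : Set.range y = V₂ := by
    refine Set.eq_of_subset_of_ncard_le (Set.range_subset_iff.2 hy2) ?_
    rw [h2, ← Set.image_univ, Set.ncard_image_of_injective _ hy, Set.ncard_univ, Nat.card_fin]
  have hxy : ∀ i j, x i ≠ y j := fun i j h => hnot _ (hx1 i) (h ▸ hy2 j)
  have hone : ∀ C, IsMinVC G C → ∀ j, ¬ (x j ∈ C ∧ y j ∈ C) := fun C hC =>
    hC.1.not_mem_both_of_matching hx hy hxy hadj (hunmixed C hC)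
  have htrans : ∀ i j l, G.Adj (x i) (y j) → G.Adj (x j) (y l) → G.Adj (x i) (y l) := by
    intro i j l hij hjl
    by_contra hil
    have hvc : IsVC G ({x i, y l}ᶜ : Finset V) := by
      intro u v huv
      by_contra! h
      simp only [Finset.mem_compl, not_not, Finset.mem_insert, Finset.mem_singleton] at h
      obtain ⟨rfl | rfl, rfl | rfl⟩ := h
      · exact G.loopless.irrefl _ huv
      · exact hil huv
      · exact hil huv.symm
      · exact G.loopless.irrefl _ huv
    obtain ⟨C, hCD, hC⟩ := hvc.exists_isMinVC_subset
    refine hone C hC j ⟨(hC.1 _ _ hjl).resolve_right fun h => ?_,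
      (hC.1 _ _ hij).resolve_left fun h => ?_⟩
    · simpa using hCD h
    · simpa using hCD h
  have hup : ∀ F, IsFacet (IndepFaces G) F → ∀ i j, G.Adj (x i) (y j) → x i ∈ F → x j ∈ F := by
    intro F hF i j hij hi
    by_contra hj
    exact hone _ hF.isMinVC_compl j
      ⟨Finset.mem_compl.2 hj, Finset.mem_compl.2 fun h => hF.1 _ hi _ h hij⟩
  have hX : IsFacet (IndepFaces G) (Finset.univ.image x) := by
    refine ⟨fun u hu v hv huv => ?_, fun F hF hsub => hsub.antisymm fun v hv => ?_⟩
    · obtain ⟨i, -, rfl⟩ := Finset.mem_image.1 hu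
      obtain ⟨j, -, rfl⟩ := Finset.mem_image.1 hv
      rcases hbip _ _ huv with h | h
      · exact hnot _ (hx1 j) h.2
      · exact hnot _ (hx1 i) h.1
    · rcases (hpart ▸ Set.mem_univ v : v ∈ V₁ ∪ V₂) with h | h
      · rw [← hxr] at h
        simpa using h
      · rw [← hyr] at h
        obtain ⟨i, rfl⟩ := h
        exact (hF _ (hsub (Finset.mem_image_of_mem x (Finset.mem_univ i))) _ hv (hadj i)).elim
  have hY : IsFacet (IndepFaces G) (Finset.univ.image y) := by
    refine ⟨fun u hu v hv huv => ?_, fun F hF hsub => hsub.antisymm fun v hv => ?_⟩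
    · obtain ⟨i, -, rfl⟩ := Finset.mem_image.1 hu
      obtain ⟨j, -, rfl⟩ := Finset.mem_image.1 hv
      rcases hbip _ _ huv with h | h
      · exact hnot _ h.1 (hy2 i)
      · exact hnot _ h.2 (hy2 j)
    · rcases (hpart ▸ Set.mem_univ v : v ∈ V₁ ∪ V₂) with h | h
      · rw [← hxr] at h
        obtain ⟨i, rfl⟩ := h
        exact (hF _ hv _ (hsub (Finset.mem_image_of_mem y (Finset.mem_univ i))) (hadj i)).elim
      · rw [← hyr] at h
        simpa using h
  have hthree : ∀ a b c, a ≠ b → a ≠ c → b ≠ c → G.Adj (x a) (y b) → G.Adj (x b) (y a) →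
      G.Adj (x a) (y c) → G.Adj (x c) (y a) → False := by
    intro a b c hab hac hbc rab rba rac rca
    obtain ⟨r, f, hf0, hfl, hf, hcard⟩ := hconn _ _ hX hY
    obtain ⟨i, hi, hi'⟩ : ∃ i : Fin r, x a ∈ f i.castSucc ∧ x a ∉ f i.succ := by
      by_contra! h
      have hall : ∀ i, x a ∈ f i := fun i =>
        Fin.induction (by rw [hf0]; exact Finset.mem_image_of_mem x (Finset.mem_univ a)) h i
      have hlast := hall (Fin.last r)
      rw [hfl] at hlast
      obtain ⟨j, -, hj⟩ := Finset.mem_image.1 hlast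
      exact hxy _ _ hj.symm
    have hFcard : (f i.castSucc).card = n := by
      have hV : Fintype.card V = n + n := by
        rw [← Nat.card_eq_fintype_card, ← Set.ncard_univ, ← hpart,
          Set.ncard_union_eq (Set.disjoint_iff_inter_eq_empty.2 hdisj), h1, h2]
      have hC := hunmixed _ (hf i.castSucc).isMinVC_compl
      have hsum := Finset.card_add_card_compl (f i.castSucc)
      omega
    have hT : ({x a, x b, x c} : Finset V).card = 3 :=
      Finset.card_eq_three.2 ⟨_, _, _, hx.ne hab, hx.ne hac, hx.ne hbc, rfl⟩
    have hTF : ({x a, x b, x c} : Finset V) ⊆ f i.castSucc := by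
      simp only [Finset.insert_subset_iff, Finset.singleton_subset_iff]
      exact ⟨hi, hup _ (hf _) _ _ rab hi, hup _ (hf _) _ _ rac hi⟩
    have hsub : f i.castSucc ∩ f i.succ ⊆ f i.castSucc \ {x a, x b, x c} := by
      intro v hv
      obtain ⟨hv, hv'⟩ := Finset.mem_inter.1 hv
      refine Finset.mem_sdiff.2 ⟨hv, fun h => ?_⟩
      simp only [Finset.mem_insert, Finset.mem_singleton] at h
      obtain rfl | rfl | rfl := h
      · exact hi' hv'
      · exact hi' (hup _ (hf _) _ _ rba hv')
      · exact hi' (hup _ (hf _) _ _ rca hv')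
    have hle1 := Finset.card_le_card hsub
    have hle2 := Finset.card_le_card hTF
    rw [Finset.card_sdiff_of_subset hTF, hFcard, hT] at hle1
    have hge := hcard i
    omega
  let P : Preorder (Fin n) :=
    { le := fun i j => G.Adj (x i) (y j)
      lt := fun i j => G.Adj (x i) (y j) ∧ ¬ G.Adj (x j) (y i)
      le_refl := hadj
      le_trans := htrans
      lt_iff_le_not_ge := fun _ _ => Iff.rfl }
  obtain ⟨σ, hσ⟩ := @exists_perm_le_succ_of_preorder n (Fin n) P id hthree
  exact ⟨x ∘ σ, y ∘ σ, hx.comp σ.injective, hy.comp σ.injective,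
    (σ.surjective.range_comp x).trans hxr, (σ.surjective.range_comp y).trans hyr,
    fun i => hadj (σ i), hσ, fun i j l => htrans _ _ _⟩
end

section
/- Let λ = (λ₁ ≥ ... ≥ λₙ) be a partition and I_λ the Ferrers edge ideal in R = k[x₁,...,xₙ,y₁,...,y_{λ₁}]. Then the height of I_λ equals min{ min_{1 ≤ j ≤ n}(λ_j + j − 1), n }. -/
open MvPolynomial

/-- The height of an ideal: the infimum of the heights (in the prime spectrum)
of the primes containing it. -/
noncomputable def idealHeight {R : Type*} [CommRing R] (I : Ideal R) : ℕ∞ :=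
  sInf {h : ℕ∞ | ∃ p : PrimeSpectrum R, I ≤ p.asIdeal ∧ Order.height p = h}

/-- The ideal generated by a set of variables is the kernel of the substitution killing them. -/
lemma span_X_image_eq_ker {σ k : Type*} [Field k] [DecidableEq σ] (S : Finset σ) :
    Ideal.span ((X : σ → MvPolynomial σ k) '' S) =
      RingHom.ker (aeval (R := k)
        (fun v => if v ∈ S then (0 : MvPolynomial σ k) else X v)) := by
  apply le_antisymm
  · rw [Ideal.span_le]
    rintro _ ⟨v, hv, rfl⟩
    simpa using hv
  · intro f hf
    set J := Ideal.span ((X : σ → MvPolynomial σ k) '' S) with hJ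
    have hcomp : (Ideal.Quotient.mkₐ k J).comp (aeval (R := k)
        (fun v => if v ∈ S then (0 : MvPolynomial σ k) else X v)) = Ideal.Quotient.mkₐ k J := by
      ext v
      by_cases hv : v ∈ S
      · have : Ideal.Quotient.mk J (X v) = 0 :=
          Ideal.Quotient.eq_zero_iff_mem.2 (Ideal.subset_span ⟨v, hv, rfl⟩)
        simp [hv, this]
      · simp [hv]
    have h := DFunLike.congr_fun hcomp f
    rw [AlgHom.comp_apply, RingHom.mem_ker.1 hf, map_zero] at h
    exact Ideal.Quotient.eq_zero_iff_mem.1 h.symm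

lemma isPrime_span_X_image {σ k : Type*} [Field k] (S : Finset σ) :
    (Ideal.span ((X : σ → MvPolynomial σ k) '' S)).IsPrime := by
  classical
  rw [span_X_image_eq_ker]
  exact RingHom.ker_isPrime _

lemma X_mem_span_X_image_iff {σ k : Type*} [Field k] {S : Finset σ} {v : σ} :
    (X v : MvPolynomial σ k) ∈ Ideal.span ((X : σ → MvPolynomial σ k) '' S) ↔ v ∈ S := by
  classical
  rw [span_X_image_eq_ker, RingHom.mem_ker]
  simp

lemma height_span_X_image_le {σ k : Type*} [Finite σ] [Field k] (S : Finset σ) :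
    (Ideal.span ((X : σ → MvPolynomial σ k) '' S)).height ≤ S.card := by
  refine (Ideal.height_le_spanFinrank _ (isPrime_span_X_image S).ne_top).trans ?_
  refine (Submodule.spanFinrank_span_le_encard _).trans ((Set.encard_image_le _ _).trans ?_)
  simp

lemma card_le_height_span_X_image {σ k : Type*} [Field k] (S : Finset σ) :
    (S.card : ℕ∞) ≤ (Ideal.span ((X : σ → MvPolynomial σ k) '' S)).height := by
  classical
  induction S using Finset.induction_on with
  | empty => simp
  | insert v S hv ih =>
    have := isPrime_span_X_image (k := k) S
    have := isPrime_span_X_image (k := k) (insert v S)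
    have hlt : Ideal.span ((X : σ → MvPolynomial σ k) '' S) <
        Ideal.span ((X : σ → MvPolynomial σ k) '' (insert v S : Finset σ)) := by
      refine lt_of_le_of_ne (Ideal.span_mono (Set.image_mono (by simp))) fun h => hv ?_
      rw [← X_mem_span_X_image_iff (k := k), h, X_mem_span_X_image_iff]
      exact Finset.mem_insert_self v S
    rw [Finset.card_insert_of_notMem hv, Nat.cast_add, Nat.cast_one]
    exact (add_le_add_left ih 1).trans (Ideal.height_add_one_le_of_lt_of_isPrime hlt)

lemma idealHeight_le_card {σ k : Type*} [Finite σ] [Field k] {I : Ideal (MvPolynomial σ k)}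
    (S : Finset σ) (h : I ≤ Ideal.span (X '' S)) : idealHeight I ≤ S.card := by
  refine le_trans (sInf_le ?_) (height_span_X_image_le (k := k) S)
  exact ⟨⟨_, isPrime_span_X_image S⟩, h, (PrimeSpectrum.height_eq_orderHeight _).symm⟩

lemma le_idealHeight {σ k : Type*} [Field k] {I : Ideal (MvPolynomial σ k)} {c : ℕ}
    (h : ∀ p : Ideal (MvPolynomial σ k), p.IsPrime → I ≤ p →
      ∃ S : Finset σ, c ≤ S.card ∧ ∀ v ∈ S, X v ∈ p) : (c : ℕ∞) ≤ idealHeight I := by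
  refine le_sInf ?_
  rintro _ ⟨p, hp, rfl⟩
  obtain ⟨S, hc, hS⟩ := h p.asIdeal p.isPrime hp
  rw [← PrimeSpectrum.height_eq_orderHeight]
  refine (Nat.cast_le.2 hc).trans ((card_le_height_span_X_image (k := k) S).trans ?_)
  refine Ideal.height_mono (Ideal.span_le.2 ?_)
  rintro _ ⟨v, hv, rfl⟩
  exact hS v hv

/-- The vertices `x_a` with `a < i` together with `y_b` with `b < l`. -/
def ferrersCover (n m i l : ℕ) : Finset (Fin n ⊕ Fin m) :=
  (Finset.univ.filter fun a : Fin n => (a : ℕ) < i).disjSum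
    (Finset.univ.filter fun b : Fin m => (b : ℕ) < l)

lemma card_ferrersCover {n m i l : ℕ} (hi : i ≤ n) (hl : l ≤ m) :
    (ferrersCover n m i l).card = l + i := by
  rw [ferrersCover, Finset.card_disjSum, Fin.card_filter_val_lt, Fin.card_filter_val_lt]
  omega

/-- For a partition `λ₁ ≥ … ≥ λₙ`, the height of the Ferrers edge ideal `I_λ` in
`k[x₁,…,xₙ,y₁,…,y_{λ₁}]` is `min{min_j (λ_j + j − 1), n}` (0-based: `λ_j + j`). -/
theorem stmt16 (k : Type*) [Field k] (n m : ℕ) (hn : 0 < n)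
    (lam : Fin n → ℕ) (hanti : ∀ i j : Fin n, i ≤ j → lam j ≤ lam i)
    (hpos : ∀ i : Fin n, 1 ≤ lam i) (hm : lam ⟨0, hn⟩ = m)
    (I : Ideal (MvPolynomial (Fin n ⊕ Fin m) k))
    (hI : I = Ideal.span {f | ∃ (i : Fin n) (j : Fin m),
      (j : ℕ) < lam i ∧ f = X (Sum.inl i) * X (Sum.inr j)}) :
    idealHeight I =
      (min (sInf {t : ℕ | ∃ j : Fin n, t = lam j + (j : ℕ)}) n : ℕ) := by
  subst hI
  set T := {t : ℕ | ∃ j : Fin n, t = lam j + (j : ℕ)}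
  have hle (i : Fin n) : lam i ≤ m := hm ▸ hanti _ _ (Fin.mk_le_of_le_val (Nat.zero_le _))
  have hcover (i l : ℕ) (hi : i ≤ n) (hl : l ≤ m)
      (h : ∀ (a : Fin n) (b : Fin m), (b : ℕ) < lam a → (a : ℕ) < i ∨ (b : ℕ) < l) :
      idealHeight (Ideal.span {f : MvPolynomial (Fin n ⊕ Fin m) k | ∃ (i : Fin n) (j : Fin m),
        (j : ℕ) < lam i ∧ f = X (Sum.inl i) * X (Sum.inr j)}) ≤ (l + i : ℕ) := by
    rw [← card_ferrersCover hi hl]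
    refine idealHeight_le_card _ (Ideal.span_le.2 ?_)
    rintro _ ⟨a, b, hab, rfl⟩
    rcases h a b hab with h | h
    · exact Ideal.mul_mem_right _ _ (X_mem_span_X_image_iff.2 (by simp [ferrersCover, h]))
    · exact Ideal.mul_mem_left _ _ (X_mem_span_X_image_iff.2 (by simp [ferrersCover, h]))
  apply le_antisymm
  · obtain ⟨j, hj⟩ : sInf T ∈ T := Nat.sInf_mem ⟨_, ⟨0, hn⟩, rfl⟩
    rw [Nat.mono_cast.map_min, le_min_iff]
    constructor
    · rw [hj]
      refine hcover j (lam j) j.2.le (hle j) fun a b hab => ?_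
      rcases lt_or_ge a j with h | h
      · exact Or.inl h
      · exact Or.inr (hab.trans_le (hanti _ _ h))
    · simpa using hcover n 0 le_rfl (Nat.zero_le _) fun a _ _ => Or.inl a.2
  · refine le_idealHeight fun p hp hIp => ?_
    by_cases hall : ∀ a : Fin n, X (Sum.inl a) ∈ p
    · refine ⟨ferrersCover n m n 0, ?_, ?_⟩
      · rw [card_ferrersCover le_rfl (Nat.zero_le _), zero_add]
        exact min_le_right _ _
      · rintro (a | b) hv
        · exact hall a
        · simp [ferrersCover] at hv
    · push Not at hall
      obtain ⟨i, hi, hmin⟩ := WellFounded.has_min (wellFounded_lt (α := Fin n))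
        {a | X (Sum.inl a) ∉ p} hall
      refine ⟨ferrersCover n m i (lam i), ?_, ?_⟩
      · rw [card_ferrersCover i.2.le (hle i)]
        exact (min_le_left _ _).trans (Nat.sInf_le ⟨i, rfl⟩)
      · rintro (a | b) hv
        · by_contra h
          exact hmin a h (by simpa [ferrersCover] using hv)
        · have hb : (b : ℕ) < lam i := by simpa [ferrersCover] using hv
          exact (hp.mem_or_mem (hIp (Ideal.subset_span ⟨i, b, hb, rfl⟩))).resolve_left hi
end
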